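/- Let A be a Banach algebra and I a closed two-sided ideal of A. If A is cyclic amenable and I has the approximate trace extension property, then the quotient Banach algebra A/I is approximately cyclic amenable. -/

import Mathlib

open Filter Topology

noncomputable section

universe u v

variable {A : Type u} [NonUnitalNormedRing A] [NormedSpace ℂ A]
  [IsScalarTower ℂ A A] [SMulCommClass ℂ A A]

/-- The left module action of `A` on its dual `A*`: `(a · f) b = f (b * a)`. -/
def lAct (a : A) (f : A →L[ℂ] ℂ) : A →L[ℂ] ℂ :=
  f.comp ((ContinuousLinearMap.mul ℂ A).flip a)

/-- The right module action of `A` on its dual `A*`: `(f · a) b = f (a * b)`. -/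
def rAct (f : A →L[ℂ] ℂ) (a : A) : A →L[ℂ] ℂ :=
  f.comp (ContinuousLinearMap.mul ℂ A a)

/-- A bounded linear `D : A → A*` is a derivation if `D (a * b) = D a · b + a · D b`. -/
def IsDerivation (D : A →L[ℂ] (A →L[ℂ] ℂ)) : Prop :=
  ∀ a b : A, D (a * b) = rAct (D a) b + lAct a (D b)

/-- A derivation `D : A → A*` is cyclic if `⟨D a, b⟩ + ⟨D b, a⟩ = 0` for all `a, b`. -/
def IsCyclicDeriv (D : A →L[ℂ] (A →L[ℂ] ℂ)) : Prop :=
  ∀ a b : A, D a b + D b a = 0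

/-- `D : A → A*` is approximately inner if there is a net `(f i)` in `A*` with
`D a = lim_i (a · f i - f i · a)` in norm, for every `a ∈ A`. -/
def IsApproxInner {A : Type u} [NonUnitalNormedRing A] [NormedSpace ℂ A]
    [IsScalarTower ℂ A A] [SMulCommClass ℂ A A] (D : A →L[ℂ] (A →L[ℂ] ℂ)) : Prop :=
  ∃ (ι : Type u) (l : Filter ι) (f : ι → (A →L[ℂ] ℂ)), l.NeBot ∧
    ∀ a : A, Tendsto (fun i => lAct a (f i) - rAct (f i) a) l (𝓝 (D a))

/-- `D : A → A*` is inner if `D a = a · f - f · a` for some fixed `f ∈ A*`. -/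
def IsInner (D : A →L[ℂ] (A →L[ℂ] ℂ)) : Prop :=
  ∃ f : A →L[ℂ] ℂ, ∀ a : A, D a = lAct a f - rAct f a

/-- A Banach algebra is approximately cyclic amenable if every cyclic bounded
derivation `D : A → A*` is approximately inner. -/
def ApproxCyclicAmenable (A : Type u) [NonUnitalNormedRing A] [NormedSpace ℂ A]
    [IsScalarTower ℂ A A] [SMulCommClass ℂ A A] : Prop :=
  ∀ D : A →L[ℂ] (A →L[ℂ] ℂ), IsDerivation D → IsCyclicDeriv D → IsApproxInner D

/-- A Banach algebra is cyclic amenable if every cyclic bounded derivation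
`D : A → A*` is inner. -/
def CyclicAmenable (A : Type u) [NonUnitalNormedRing A] [NormedSpace ℂ A]
    [IsScalarTower ℂ A A] [SMulCommClass ℂ A A] : Prop :=
  ∀ D : A →L[ℂ] (A →L[ℂ] ℂ), IsDerivation D → IsCyclicDeriv D → IsInner D

/-- A closed two-sided ideal `I` of `A` has the approximate trace extension property if every
`f ∈ I*` with `a · f = f · a` for all `a ∈ A` admits a net `(g i)` in `A*` with
`g i |_I = f` for all `i` and `a · g i - g i · a → 0` in norm for every `a ∈ A`. -/
def HasApproxTraceExt {A : Type u} [NonUnitalNormedRing A] [NormedSpace ℂ A]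
    [IsScalarTower ℂ A A] [SMulCommClass ℂ A A] (I : Submodule ℂ A)
    (hr : ∀ (a : A), ∀ x ∈ I, x * a ∈ I) (hl : ∀ (a : A), ∀ x ∈ I, a * x ∈ I) : Prop :=
  ∀ f : ↥I →L[ℂ] ℂ,
    (∀ (a : A) (x : ↥I), f ⟨a * (x : A), hl a x x.2⟩ = f ⟨(x : A) * a, hr a x x.2⟩) →
    ∃ (ι : Type u) (l : Filter ι) (g : ι → (A →L[ℂ] ℂ)), l.NeBot ∧
      (∀ i, ∀ x : ↥I, g i (x : A) = f x) ∧
      (∀ a : A, Tendsto (fun i => lAct a (g i) - rAct (g i) a) l (𝓝 0))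

/-- A functional vanishing on the kernel of a surjective bounded operator factors through it. -/
theorem exists_comp_eq_of_ker_le {E F : Type*} [NormedAddCommGroup E] [NormedSpace ℂ E]
    [CompleteSpace E] [NormedAddCommGroup F] [NormedSpace ℂ F] [CompleteSpace F]
    (π : E →L[ℂ] F) (hsurj : Function.Surjective π) (φ : E →L[ℂ] ℂ)
    (hφ : ∀ x, π x = 0 → φ x = 0) : ∃ ψ : F →L[ℂ] ℂ, ψ.comp π = φ := by
  obtain ⟨C, -, hC⟩ := π.exists_preimage_norm_le hsurj
  choose s hs hsC using hC
  have key : ∀ x y, π x = π y → φ x = φ y := fun x y h => by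
    have := hφ (x - y) (by rw [map_sub, h, sub_self])
    rwa [map_sub, sub_eq_zero] at this
  let ψ : F →ₗ[ℂ] ℂ :=
    { toFun := fun q => φ (s q)
      map_add' := fun p q => by
        rw [← map_add]
        exact key _ _ (by rw [map_add, hs, hs, hs])
      map_smul' := fun c q => by
        rw [RingHom.id_apply, ← map_smul]
        exact key _ _ (by rw [map_smul, hs, hs]) }
  refine ⟨ψ.mkContinuous (‖φ‖ * C) fun q => ?_, ?_⟩
  · calc ‖φ (s q)‖ ≤ ‖φ‖ * ‖s q‖ := φ.le_opNorm _
      _ ≤ ‖φ‖ * (C * ‖q‖) := by gcongr; exact hsC q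
      _ = ‖φ‖ * C * ‖q‖ := by ring
  · ext x
    exact key _ _ (hs _)

/-- The adjoint of a surjective bounded operator is bounded below. -/
theorem exists_norm_le_mul_norm_comp {E F : Type*} [NormedAddCommGroup E] [NormedSpace ℂ E]
    [CompleteSpace E] [NormedAddCommGroup F] [NormedSpace ℂ F] [CompleteSpace F]
    (π : E →L[ℂ] F) (hsurj : Function.Surjective π) :
    ∃ C : ℝ, ∀ ψ : F →L[ℂ] ℂ, ‖ψ‖ ≤ C * ‖ψ.comp π‖ := by
  obtain ⟨C, hC0, hC⟩ := π.exists_preimage_norm_le hsurj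
  refine ⟨C, fun ψ => ψ.opNorm_le_bound (by positivity) fun q => ?_⟩
  obtain ⟨x, rfl, hx⟩ := hC q
  calc ‖ψ (π x)‖ ≤ ‖ψ.comp π‖ * ‖x‖ := (ψ.comp π).le_opNorm x
    _ ≤ ‖ψ.comp π‖ * (C * ‖π x‖) := by gcongr
    _ = C * ‖ψ.comp π‖ * ‖π x‖ := by ring

/-- If `A` is cyclic amenable and the closed two-sided ideal `I` has the
approximate trace extension property, then the quotient Banach algebra `A/I` is
approximately cyclic amenable.  (The quotient is represented by a Banach algebra `Q`
together with a surjective continuous multiplicative linear map `π : A → Q` with kernel `I`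
and the quotient norm.) -/
theorem quotient_approxCyclicAmenable_of_cyclicAmenable
    {A : Type u} {Q : Type v} [NonUnitalNormedRing A] [NormedSpace ℂ A]
    [IsScalarTower ℂ A A] [SMulCommClass ℂ A A] [CompleteSpace A]
    [NonUnitalNormedRing Q] [NormedSpace ℂ Q]
    [IsScalarTower ℂ Q Q] [SMulCommClass ℂ Q Q] [CompleteSpace Q]
    (I : Submodule ℂ A) (hclosed : IsClosed (I : Set A))
    (hr : ∀ (a : A), ∀ x ∈ I, x * a ∈ I) (hl : ∀ (a : A), ∀ x ∈ I, a * x ∈ I)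
    (π : A →L[ℂ] Q) (hmul : ∀ x y : A, π (x * y) = π x * π y)
    (hsurj : Function.Surjective π) (hker : ∀ a : A, π a = 0 ↔ a ∈ I)
    (hnorm : ∀ q : Q, ‖q‖ = sInf (norm '' (π ⁻¹' {q})))
    (hA : CyclicAmenable A) (hI : HasApproxTraceExt I hr hl) :
    ApproxCyclicAmenable Q := by
  intro D hD hcyc
  let T : A →L[ℂ] (A →L[ℂ] ℂ) :=
    ((ContinuousLinearMap.compL ℂ A Q ℂ).flip π).comp (D.comp π)
  have hT : ∀ a b, T a b = D (π a) (π b) := fun _ _ => rfl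
  obtain ⟨f, hf⟩ := hA T
    (fun a b => by
      ext c
      have := DFunLike.congr_fun (hD (π a) (π b)) (π c)
      simpa [hT, lAct, rAct, hmul] using this)
    (fun a b => hcyc _ _)
  have hfT : ∀ a b, D (π a) (π b) = f (b * a) - f (a * b) := fun a b =>
    DFunLike.congr_fun (hf a) b
  obtain ⟨ι, l, g, hl_bot, hgI, hg⟩ := hI (f.comp I.subtypeL) fun a x => by
    have := hfT a x
    rw [(hker x).2 x.2, map_zero] at this
    exact (sub_eq_zero.1 this.symm).symm
  choose h hh using fun i => exists_comp_eq_of_ker_le π hsurj (f - g i) fun x hx => by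
    have := hgI i ⟨x, (hker x).1 hx⟩
    exact sub_eq_zero.2 this.symm
  have hh' : ∀ i x, h i (π x) = f x - g i x := fun i x => DFunLike.congr_fun (hh i) x
  obtain ⟨C, hC⟩ := exists_norm_le_mul_norm_comp π hsurj
  refine ⟨Q →L[ℂ] ℂ, l.map h, id, hl_bot.map h, fun q => tendsto_map'_iff.2 ?_⟩
  obtain ⟨a, rfl⟩ := hsurj q
  have hcomp : ∀ i, (lAct (π a) (h i) - rAct (h i) (π a) - D (π a)).comp π =
      -(lAct a (g i) - rAct (g i) a) := fun i => by
    ext b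
    have e : (h i) (π b * π a) - (h i) (π a * π b) - D (π a) (π b) =
        -(g i (b * a) - g i (a * b)) := by
      rw [← hmul, ← hmul, hh', hh', hfT]
      ring
    exact e
  rw [tendsto_iff_norm_sub_tendsto_zero]
  refine squeeze_zero (fun _ => norm_nonneg _) (fun i => hC _) ?_
  simpa only [Function.comp_apply, id, hcomp, norm_neg, norm_zero, mul_zero] using
    (hg a).norm.const_mul C
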